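/- Let k ∈ (0,1). Then the function h(u) := k² sn(u,k) cn(u,k)/dn(u,k) − zn(u,k) satisfies h(0) = h(K(k)) = 0 and h(u) > 0 for all u ∈ (0, K(k)); moreover h''(u) = −2k²k'² sn(u,k) cn(u,k)/dn³(u,k) < 0 for u ∈ (0, K(k)), where k' = √(1−k²). -/

import Mathlib

open Real

/-- Complete elliptic integral of the first kind. -/
noncomputable def EllK (k : ℝ) : ℝ :=
  ∫ θ in (0:ℝ)..(π/2), 1 / Real.sqrt (1 - k^2 * Real.sin θ ^ 2)

/-- Complete elliptic integral of the second kind. -/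
noncomputable def EllE (k : ℝ) : ℝ :=
  ∫ θ in (0:ℝ)..(π/2), Real.sqrt (1 - k^2 * Real.sin θ ^ 2)

/-- Complementary complete elliptic integral `K'(k) = K(√(1-k²))`. -/
noncomputable def EllK' (k : ℝ) : ℝ := EllK (Real.sqrt (1 - k^2))

/-- Complementary elliptic integral of the second kind `E'(k) = E(√(1-k²))`. -/
noncomputable def EllE' (k : ℝ) : ℝ := EllE (Real.sqrt (1 - k^2))

/-- The nome `q = exp(-π K'(k)/K(k))`. -/
noncomputable def nome (k : ℝ) : ℝ := Real.exp (-π * EllK' k / EllK k)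

/-- Jacobi's theta function `Θ(u,k) = 1 + 2 ∑_{n≥1} (-1)^n q^{n²} cos(nπu/K)`. -/
noncomputable def JTheta (u k : ℝ) : ℝ :=
  1 + 2 * ∑' n : ℕ, (-1 : ℝ)^(n+1) * nome k ^ ((n+1)^2) *
    Real.cos (((n:ℝ)+1) * π * u / EllK k)

/-- Jacobi's theta function `H(u,k) = 2 ∑_{n≥0} (-1)^n q^{(n+1/2)²} sin((2n+1)πu/(2K))`. -/
noncomputable def JH (u k : ℝ) : ℝ :=
  2 * ∑' n : ℕ, (-1 : ℝ)^n * nome k ^ ((((n:ℝ) + 1/2)^2)) *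
    Real.sin ((2*(n:ℝ)+1) * π * u / (2 * EllK k))

/-- Jacobi's theta function `H₁(u,k) = 2 ∑_{n≥0} q^{(n+1/2)²} cos((2n+1)πu/(2K))`. -/
noncomputable def JH1 (u k : ℝ) : ℝ :=
  2 * ∑' n : ℕ, nome k ^ ((((n:ℝ) + 1/2)^2)) *
    Real.cos ((2*(n:ℝ)+1) * π * u / (2 * EllK k))

/-- Jacobi's theta function `Θ₁(u,k) = 1 + 2 ∑_{n≥1} q^{n²} cos(nπu/K)`. -/
noncomputable def JTheta1 (u k : ℝ) : ℝ :=
  1 + 2 * ∑' n : ℕ, nome k ^ ((n+1)^2) * Real.cos (((n:ℝ)+1) * π * u / EllK k)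

/-- Jacobi's zeta function `zn(u,k) = Θ_u(u,k)/Θ(u,k)`. -/
noncomputable def zn (u k : ℝ) : ℝ := deriv (fun v => JTheta v k) u / JTheta u k

/-- Jacobi's elliptic sine `sn(u,k) = H(u,k)/(√k Θ(u,k))`. -/
noncomputable def sn (u k : ℝ) : ℝ := JH u k / (Real.sqrt k * JTheta u k)

/-- Jacobi's elliptic cosine `cn(u,k) = √(k'/k) H₁(u,k)/Θ(u,k)`. -/
noncomputable def cn (u k : ℝ) : ℝ :=
  Real.sqrt (Real.sqrt (1 - k^2) / k) * JH1 u k / JTheta u k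

/-- Jacobi's delta amplitude `dn(u,k) = √(k') Θ₁(u,k)/Θ(u,k)`. -/
noncomputable def dn (u k : ℝ) : ℝ :=
  Real.sqrt (Real.sqrt (1 - k^2)) * JTheta1 u k / JTheta u k

open HurwitzZeta
open HurwitzKernelBounds (summable_f_int f_int)

/-- The real theta series `∑ exp (-π (n + a)² t) cos (2 (n + a) z)` over the integers. -/
noncomputable def thetaCos (a t z : ℝ) : ℝ :=
  ∑' n : ℤ, rexp (-π * (n + a) ^ 2 * t) * cos (2 * (n + a) * z)

/-- The derivative of `thetaCos` in its last argument. -/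
noncomputable def thetaCosD (a t z : ℝ) : ℝ :=
  ∑' n : ℤ, rexp (-π * (n + a) ^ 2 * t) * (-sin (2 * (n + a) * z) * (2 * (n + a)))

/-- The second derivative of `thetaCos` in its last argument. -/
noncomputable def thetaCosDD (a t z : ℝ) : ℝ :=
  ∑' n : ℤ, rexp (-π * (n + a) ^ 2 * t) * (-(cos (2 * (n + a) * z) * (2 * (n + a))) * (2 * (n + a)))

lemma summable_exp_mul_pow (j : ℕ) (a : ℝ) {t : ℝ} (ht : 0 < t) :
    Summable fun n : ℤ => rexp (-π * (n + a) ^ 2 * t) * |2 * ((n : ℝ) + a)| ^ j := by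
  refine ((summable_f_int j a ht).mul_left (2 ^ j)).congr fun n => ?_
  rw [f_int, abs_mul, mul_pow, abs_two]; ring

lemma summable_thetaCos (a : ℝ) {t : ℝ} (ht : 0 < t) (z : ℝ) :
    Summable fun n : ℤ => rexp (-π * (n + a) ^ 2 * t) * cos (2 * (n + a) * z) := by
  refine (summable_exp_mul_pow 0 a ht).of_norm_bounded fun n => ?_
  rw [norm_mul, norm_of_nonneg (exp_pos _).le, pow_zero]
  gcongr
  exact abs_cos_le_one _

lemma summable_thetaCosD (a : ℝ) {t : ℝ} (ht : 0 < t) (z : ℝ) :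
    Summable fun n : ℤ =>
      rexp (-π * (n + a) ^ 2 * t) * (-sin (2 * (n + a) * z) * (2 * (n + a))) := by
  refine (summable_exp_mul_pow 1 a ht).of_norm_bounded fun n => ?_
  rw [norm_mul, norm_of_nonneg (exp_pos _).le, pow_one, norm_mul, norm_neg]
  gcongr
  exact mul_le_of_le_one_left (abs_nonneg _) (abs_sin_le_one _)

lemma hasDerivAt_thetaCos (a : ℝ) {t : ℝ} (ht : 0 < t) (z : ℝ) :
    HasDerivAt (thetaCos a t) (thetaCosD a t z) z := by
  refine hasDerivAt_tsum (summable_exp_mul_pow 1 a ht)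
    (g := fun (n : ℤ) z => rexp (-π * (n + a) ^ 2 * t) * cos (2 * (n + a) * z))
    (g' := fun (n : ℤ) z => rexp (-π * (n + a) ^ 2 * t) * (-sin (2 * (n + a) * z) * (2 * (n + a))))
    ?_ ?_ (summable_thetaCos a ht 0) z
  · intro n y
    exact (((hasDerivAt_id y).const_mul (2 * ((n : ℝ) + a))).cos.const_mul _).congr_deriv (by simp)
  · intro n y
    rw [norm_mul, norm_of_nonneg (exp_pos _).le, pow_one, norm_mul, norm_neg]
    gcongr
    exact mul_le_of_le_one_left (abs_nonneg _) (abs_sin_le_one _)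

lemma hasDerivAt_thetaCosD (a : ℝ) {t : ℝ} (ht : 0 < t) (z : ℝ) :
    HasDerivAt (thetaCosD a t) (thetaCosDD a t z) z := by
  refine hasDerivAt_tsum (summable_exp_mul_pow 2 a ht)
    (g := fun (n : ℤ) z => rexp (-π * (n + a) ^ 2 * t) * (-sin (2 * (n + a) * z) * (2 * (n + a))))
    (g' := fun (n : ℤ) z =>
      rexp (-π * (n + a) ^ 2 * t) * (-(cos (2 * (n + a) * z) * (2 * (n + a))) * (2 * (n + a))))
    ?_ ?_ (summable_thetaCosD a ht 0) z
  · intro n y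
    exact ((((hasDerivAt_id y).const_mul (2 * ((n : ℝ) + a))).sin.neg.mul_const _).const_mul
      _).congr_deriv (by simp)
  · intro n y
    rw [norm_mul, norm_of_nonneg (exp_pos _).le, norm_mul, norm_neg, norm_mul]
    refine mul_le_mul_of_nonneg_left ?_ (exp_pos _).le
    rw [mul_assoc, ← sq]
    exact mul_le_of_le_one_left (sq_nonneg _) (abs_cos_le_one _)

lemma continuous_thetaCos (a : ℝ) {t : ℝ} (ht : 0 < t) : Continuous (thetaCos a t) :=
  continuous_iff_continuousAt.2 fun z => (hasDerivAt_thetaCos a ht z).continuousAt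

lemma continuous_thetaCosD (a : ℝ) {t : ℝ} (ht : 0 < t) : Continuous (thetaCosD a t) :=
  continuous_iff_continuousAt.2 fun z => (hasDerivAt_thetaCosD a ht z).continuousAt

lemma thetaCos_neg (a t z : ℝ) : thetaCos a t (-z) = thetaCos a t z := by
  simp [thetaCos]

lemma thetaCosD_neg (a t z : ℝ) : thetaCosD a t (-z) = -thetaCosD a t z := by
  simp [thetaCosD, ← tsum_neg]

lemma thetaCos_add_one (a t z : ℝ) : thetaCos (a + 1) t z = thetaCos a t z := by
  rw [thetaCos, thetaCos, ← (Equiv.addRight (1 : ℤ)).tsum_eq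
    fun n : ℤ => rexp (-π * (n + a) ^ 2 * t) * cos (2 * (n + a) * z)]
  refine tsum_congr fun n => ?_
  simp only [Equiv.coe_addRight, Int.cast_add, Int.cast_one]
  rw [show (n : ℝ) + 1 + a = n + (a + 1) by ring]

lemma thetaCos_zero_add_pi (t z : ℝ) : thetaCos 0 t (z + π) = thetaCos 0 t z := by
  refine tsum_congr fun n => ?_
  rw [show 2 * ((n : ℝ) + 0) * (z + π) = 2 * (n + 0) * z + n * (2 * π) by ring,
    cos_add_int_mul_two_pi]

lemma thetaCosD_zero_add_pi (t z : ℝ) : thetaCosD 0 t (z + π) = thetaCosD 0 t z := by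
  refine tsum_congr fun n => ?_
  rw [show 2 * ((n : ℝ) + 0) * (z + π) = 2 * (n + 0) * z + n * (2 * π) by ring,
    sin_add_int_mul_two_pi]

lemma thetaCos_half_add_pi (t z : ℝ) : thetaCos (1 / 2) t (z + π) = -thetaCos (1 / 2) t z := by
  rw [thetaCos, thetaCos, ← tsum_neg]
  refine tsum_congr fun n => ?_
  rw [show 2 * ((n : ℝ) + 1 / 2) * (z + π) = 2 * (n + 1 / 2) * z + n * (2 * π) + π by ring,
    cos_add_pi, cos_add_int_mul_two_pi]
  ring

lemma thetaCosD_apply_zero (a t : ℝ) : thetaCosD a t 0 = 0 := by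
  simp [thetaCosD]

lemma thetaCosD_zero_apply_pi_div_two (t : ℝ) : thetaCosD 0 t (π / 2) = 0 := by
  have h := thetaCosD_zero_add_pi t (-(π / 2))
  rw [thetaCosD_neg, show -(π / 2) + π = π / 2 by ring] at h
  linarith

lemma thetaCos_half_apply_pi_div_two (t : ℝ) : thetaCos (1 / 2) t (π / 2) = 0 := by
  have h := thetaCos_half_add_pi t (-(π / 2))
  rw [thetaCos_neg, show -(π / 2) + π = π / 2 by ring] at h
  linarith

/-- The complex theta series whose real part is `thetaCos`. -/
noncomputable def thetaExp (a t z : ℝ) : ℂ :=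
  ∑' n : ℤ, Complex.exp (((-π * (n + a) ^ 2 * t : ℝ) : ℂ) + ((2 * (n + a) * z : ℝ) : ℂ) * Complex.I)

lemma summable_norm_thetaExp (a : ℝ) {t : ℝ} (ht : 0 < t) (z : ℝ) :
    Summable fun n : ℤ => ‖Complex.exp
      (((-π * (n + a) ^ 2 * t : ℝ) : ℂ) + ((2 * (n + a) * z : ℝ) : ℂ) * Complex.I)‖ := by
  refine (summable_exp_mul_pow 0 a ht).congr fun n => ?_
  rw [Complex.exp_add, norm_mul, Complex.norm_exp_ofReal_mul_I, ← Complex.ofReal_exp,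
    Complex.norm_real, norm_of_nonneg (exp_pos _).le, pow_zero]

lemma thetaExp_eq_thetaCos (a : ℝ) (m : ℤ) (hm : 2 * a = m) {t : ℝ} (ht : 0 < t) (z : ℝ) :
    thetaExp a t z = (thetaCos a t z : ℂ) := by
  have hs := summable_norm_thetaExp a ht z
  have hre : (thetaExp a t z).re = thetaCos a t z := by
    rw [thetaExp, Complex.re_tsum hs.of_norm]
    refine tsum_congr fun n => ?_
    rw [Complex.exp_re, Complex.add_re, Complex.add_im, Complex.re_ofReal_mul,
      Complex.im_ofReal_mul, Complex.ofReal_re, Complex.ofReal_im, Complex.I_re, Complex.I_im]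
    simp
  have him : (thetaExp a t z).im = 0 := by
    have h1 : (thetaExp a t z).im =
        ∑' n : ℤ, rexp (-π * (n + a) ^ 2 * t) * sin (2 * (n + a) * z) := by
      rw [thetaExp, Complex.im_tsum hs.of_norm]
      refine tsum_congr fun n => ?_
      rw [Complex.exp_im, Complex.add_re, Complex.add_im, Complex.re_ofReal_mul,
        Complex.im_ofReal_mul, Complex.ofReal_re, Complex.ofReal_im, Complex.I_re, Complex.I_im]
      simp
    have h2 : (thetaExp a t z).im = -(thetaExp a t z).im := by
      rw [h1, ← tsum_neg, ← (Equiv.subLeft (-m)).tsum_eq]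
      refine tsum_congr fun n => ?_
      simp only [Equiv.subLeft_apply, Int.cast_sub, Int.cast_neg, ← hm]
      rw [show -(2 * a) - (n : ℝ) + a = -(n + a) by ring, neg_sq,
        show 2 * -((n : ℝ) + a) * z = -(2 * (n + a) * z) by ring, sin_neg]
      ring
    linarith
  exact Complex.ext (by simpa using hre) (by simpa using him)

/-- Pairs of integers, split according to the parity of their sum. -/
def sumDiffEquiv : (ℤ × ℤ) ⊕ (ℤ × ℤ) ≃ ℤ × ℤ where
  toFun := Sum.elim (fun p => (p.1 + p.2, p.1 - p.2)) (fun p => (p.1 + p.2 + 1, p.1 - p.2))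
  invFun p := if (p.1 + p.2) % 2 = 0 then .inl ((p.1 + p.2) / 2, (p.1 - p.2) / 2)
    else .inr ((p.1 + p.2) / 2, (p.1 - p.2) / 2)
  left_inv := by
    rintro (⟨i, j⟩ | ⟨i, j⟩)
    · refine (if_pos (by simp only [Sum.elim_inl]; omega)).trans ?_
      simp only [Sum.elim_inl, Sum.inl.injEq, Prod.mk.injEq]
      omega
    · refine (if_neg (by simp only [Sum.elim_inr]; omega)).trans ?_
      simp only [Sum.elim_inr, Sum.inr.injEq, Prod.mk.injEq]
      omega
  right_inv := by
    rintro ⟨m, n⟩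
    by_cases h : (m + n) % 2 = 0
    · simp only [if_pos h, Sum.elim_inl, Prod.mk.injEq]
      omega
    · simp only [if_neg h, Sum.elim_inr, Prod.mk.injEq]
      omega

lemma thetaExp_mul_thetaExp (a : ℝ) {t : ℝ} (ht : 0 < t) (x y : ℝ) :
    thetaExp a t x * thetaExp a t y =
      thetaExp a (2 * t) (x + y) * thetaExp 0 (2 * t) (x - y) +
        thetaExp (a + 1 / 2) (2 * t) (x + y) * thetaExp (1 / 2) (2 * t) (x - y) := by
  have ht2 : 0 < 2 * t := by positivity
  have hp := fun (b c z w : ℝ) (s : ℝ) (hs : 0 < s) =>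
    (summable_mul_of_summable_norm (summable_norm_thetaExp b hs z) (summable_norm_thetaExp c hs w))
  simp only [thetaExp]
  rw [tsum_mul_tsum_of_summable_norm (summable_norm_thetaExp _ ht _) (summable_norm_thetaExp _ ht _),
    tsum_mul_tsum_of_summable_norm (summable_norm_thetaExp _ ht2 _) (summable_norm_thetaExp _ ht2 _),
    tsum_mul_tsum_of_summable_norm (summable_norm_thetaExp _ ht2 _) (summable_norm_thetaExp _ ht2 _),
    ← sumDiffEquiv.tsum_eq, Summable.tsum_sum]
  · congr 1 <;>
    · refine tsum_congr fun p => ?_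
      rw [← Complex.exp_add, ← Complex.exp_add]
      congr 1
      simp only [sumDiffEquiv, Equiv.coe_fn_mk, Sum.elim_inl, Sum.elim_inr]
      push_cast
      ring
  · exact ((hp a a x y t ht).comp_injective sumDiffEquiv.injective).comp_injective
      Sum.inl_injective
  · exact ((hp a a x y t ht).comp_injective sumDiffEquiv.injective).comp_injective
      Sum.inr_injective

lemma thetaCos_zero_mul {t : ℝ} (ht : 0 < t) (x y : ℝ) :
    thetaCos 0 t x * thetaCos 0 t y =
      thetaCos 0 (2 * t) (x + y) * thetaCos 0 (2 * t) (x - y) +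
        thetaCos (1 / 2) (2 * t) (x + y) * thetaCos (1 / 2) (2 * t) (x - y) := by
  have ht2 : 0 < 2 * t := by positivity
  have h0 := fun {s : ℝ} (hs : 0 < s) z => thetaExp_eq_thetaCos 0 0 (by simp) hs z
  have h1 := fun {s : ℝ} (hs : 0 < s) z => thetaExp_eq_thetaCos (1 / 2) 1 (by norm_num) hs z
  have h := thetaExp_mul_thetaExp 0 ht x y
  rw [zero_add, h0 ht, h0 ht, h0 ht2, h0 ht2, h1 ht2, h1 ht2] at h
  exact_mod_cast h

lemma thetaCos_half_mul {t : ℝ} (ht : 0 < t) (x y : ℝ) :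
    thetaCos (1 / 2) t x * thetaCos (1 / 2) t y =
      thetaCos (1 / 2) (2 * t) (x + y) * thetaCos 0 (2 * t) (x - y) +
        thetaCos 0 (2 * t) (x + y) * thetaCos (1 / 2) (2 * t) (x - y) := by
  have ht2 : 0 < 2 * t := by positivity
  have h0 := fun {s : ℝ} (hs : 0 < s) z => thetaExp_eq_thetaCos 0 0 (by simp) hs z
  have h1 := fun {s : ℝ} (hs : 0 < s) z => thetaExp_eq_thetaCos (1 / 2) 1 (by norm_num) hs z
  have h2 := fun {s : ℝ} (hs : 0 < s) z => thetaExp_eq_thetaCos (0 + 1) 2 (by norm_num) hs z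
  have h := thetaExp_mul_thetaExp (1 / 2) ht x y
  rw [show (1 / 2 + 1 / 2 : ℝ) = 0 + 1 by norm_num, h1 ht, h1 ht, h1 ht2, h0 ht2, h2 ht2, h1 ht2,
    thetaCos_add_one] at h
  exact_mod_cast h

lemma thetaCos_zero_eq_cosKernel {t : ℝ} (ht : 0 < t) (z : ℝ) :
    thetaCos 0 t z = cosKernel ((z / π : ℝ) : UnitAddCircle) t := by
  have h := (Complex.hasSum_re (hasSum_int_cosKernel (z / π) ht)).tsum_eq
  rw [Complex.ofReal_re] at h
  rw [← h]
  refine tsum_congr fun n => ?_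
  rw [Complex.re_mul_ofReal, show 2 * (π : ℂ) * Complex.I * ((z / π : ℝ) : ℂ) * n =
    ((2 * n * z : ℝ) : ℂ) * Complex.I by
      push_cast; field_simp [Complex.ofReal_ne_zero.2 pi_ne_zero], Complex.exp_ofReal_mul_I_re,
    add_zero, mul_comm]

lemma thetaCos_apply_zero_eq_evenKernel (a : ℝ) {t : ℝ} (ht : 0 < t) :
    thetaCos a t 0 = evenKernel (a : UnitAddCircle) t := by
  rw [← (hasSum_int_evenKernel a ht).tsum_eq]
  simp [thetaCos]

lemma evenKernel_pos (a : ℝ) {t : ℝ} (ht : 0 < t) : 0 < evenKernel (a : UnitAddCircle) t := by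
  have h := hasSum_int_evenKernel a ht
  rw [← h.tsum_eq]
  exact h.summable.tsum_pos (fun n => (exp_pos _).le) 0 (exp_pos _)

lemma thetaCos_apply_zero_pos (a : ℝ) {t : ℝ} (ht : 0 < t) : 0 < thetaCos a t 0 := by
  rw [thetaCos_apply_zero_eq_evenKernel a ht]
  exact evenKernel_pos a ht

lemma thetaCos_zero_pos {t : ℝ} (ht : 0 < t) (z : ℝ) : 0 < thetaCos 0 t z := by
  have h := evenKernel_functional_equation ((z / π : ℝ) : UnitAddCircle) (1 / t)
  rw [one_div_one_div, ← thetaCos_zero_eq_cosKernel ht] at h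
  have h1 := evenKernel_pos (z / π) (one_div_pos.2 ht)
  rw [h] at h1
  exact pos_of_mul_pos_right h1 (by positivity)

lemma thetaCos_zero_sq {t : ℝ} (ht : 0 < t) (z : ℝ) :
    thetaCos 0 t z ^ 2 = thetaCos 0 (2 * t) (2 * z) * thetaCos 0 (2 * t) 0 +
      thetaCos (1 / 2) (2 * t) (2 * z) * thetaCos (1 / 2) (2 * t) 0 := by
  rw [sq, thetaCos_zero_mul ht, sub_self, two_mul z]

lemma thetaCos_half_sq {t : ℝ} (ht : 0 < t) (z : ℝ) :
    thetaCos (1 / 2) t z ^ 2 = thetaCos (1 / 2) (2 * t) (2 * z) * thetaCos 0 (2 * t) 0 +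
      thetaCos 0 (2 * t) (2 * z) * thetaCos (1 / 2) (2 * t) 0 := by
  rw [sq, thetaCos_half_mul ht, sub_self, two_mul z]

lemma thetaCos_zero_add_sq {t : ℝ} (ht : 0 < t) (z : ℝ) :
    thetaCos 0 t (z + π / 2) ^ 2 = thetaCos 0 (2 * t) (2 * z) * thetaCos 0 (2 * t) 0 -
      thetaCos (1 / 2) (2 * t) (2 * z) * thetaCos (1 / 2) (2 * t) 0 := by
  rw [thetaCos_zero_sq ht, show 2 * (z + π / 2) = 2 * z + π by ring, thetaCos_zero_add_pi,
    thetaCos_half_add_pi]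
  ring

lemma thetaCos_half_add_sq {t : ℝ} (ht : 0 < t) (z : ℝ) :
    thetaCos (1 / 2) t (z + π / 2) ^ 2 = thetaCos 0 (2 * t) (2 * z) * thetaCos (1 / 2) (2 * t) 0 -
      thetaCos (1 / 2) (2 * t) (2 * z) * thetaCos 0 (2 * t) 0 := by
  rw [thetaCos_half_sq ht, show 2 * (z + π / 2) = 2 * z + π by ring, thetaCos_zero_add_pi,
    thetaCos_half_add_pi]
  ring

lemma thetaCos_half_mul_shift {t : ℝ} (ht : 0 < t) (z : ℝ) :
    thetaCos (1 / 2) t z * thetaCos (1 / 2) t (z + π / 2) =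
      thetaCos (1 / 2) (2 * t) (2 * z + π / 2) * thetaCos 0 (2 * t) (π / 2) := by
  rw [thetaCos_half_mul ht, show z - (z + π / 2) = -(π / 2) by ring, thetaCos_neg, thetaCos_neg,
    thetaCos_half_apply_pi_div_two, show z + (z + π / 2) = 2 * z + π / 2 by ring]
  ring

/-- The identity behind `sn² + cn² = 1`. -/
lemma theta_sn_cn {t : ℝ} (ht : 0 < t) (z : ℝ) :
    thetaCos 0 t 0 ^ 2 * thetaCos (1 / 2) t (z + π / 2) ^ 2 +
      thetaCos 0 t (π / 2) ^ 2 * thetaCos (1 / 2) t z ^ 2 =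
    thetaCos (1 / 2) t 0 ^ 2 * thetaCos 0 t (z + π / 2) ^ 2 := by
  have h := thetaCos_zero_add_sq ht 0
  rw [zero_add] at h
  rw [thetaCos_half_add_sq ht, thetaCos_zero_add_sq ht, h, thetaCos_half_sq ht, thetaCos_half_sq ht,
    thetaCos_zero_sq ht, mul_zero]
  ring

/-- The identity behind `dn² + k² sn² = 1`. -/
lemma theta_dn_sn {t : ℝ} (ht : 0 < t) (z : ℝ) :
    thetaCos 0 t (π / 2) ^ 2 * thetaCos 0 t z ^ 2 +
      thetaCos (1 / 2) t 0 ^ 2 * thetaCos (1 / 2) t (z + π / 2) ^ 2 =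
    thetaCos 0 t 0 ^ 2 * thetaCos 0 t (z + π / 2) ^ 2 := by
  have h := thetaCos_zero_add_sq ht 0
  rw [zero_add] at h
  rw [thetaCos_half_add_sq ht, thetaCos_zero_add_sq ht, h, thetaCos_half_sq ht, thetaCos_zero_sq ht,
    thetaCos_zero_sq ht, mul_zero]
  ring

/-- Jacobi's identity `θ₂⁴ + θ₄⁴ = θ₃⁴`. -/
lemma theta_jacobi_identity {t : ℝ} (ht : 0 < t) :
    thetaCos (1 / 2) t 0 ^ 4 + thetaCos 0 t (π / 2) ^ 4 = thetaCos 0 t 0 ^ 4 := by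
  have h := thetaCos_zero_add_sq ht 0
  rw [zero_add] at h
  have h1 := thetaCos_zero_sq ht 0
  have h2 := thetaCos_half_sq ht 0
  rw [mul_zero] at h h1 h2
  rw [show (4 : ℕ) = 2 * 2 from rfl, pow_mul, pow_mul, pow_mul, h, h1, h2]
  ring

lemma exists_theta_wronskian {t : ℝ} (ht : 0 < t) :
    ∃ c : ℝ, ∀ z, thetaCosD 0 t z * thetaCos 0 t (z + π / 2) -
      thetaCos 0 t z * thetaCosD 0 t (z + π / 2) =
        c * (thetaCos (1 / 2) t z * thetaCos (1 / 2) t (z + π / 2)) := by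
  have ht2 : 0 < 2 * t := by positivity
  refine ⟨2 * thetaCosD (1 / 2) (2 * t) (-(π / 2)) / thetaCos 0 (2 * t) (π / 2), fun z => ?_⟩
  have hp := thetaCos_zero_pos ht2 (π / 2)
  have e : (fun w => thetaCos 0 t (z + w) * thetaCos 0 t (z + π / 2 - w)) = fun w =>
      thetaCos 0 (2 * t) (2 * z + π / 2) * thetaCos 0 (2 * t) (2 * w - π / 2) +
        thetaCos (1 / 2) (2 * t) (2 * z + π / 2) * thetaCos (1 / 2) (2 * t) (2 * w - π / 2) := by
    funext w
    rw [thetaCos_zero_mul ht]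
    ring_nf
  have hl : HasDerivAt (fun w => thetaCos 0 t (z + w) * thetaCos 0 t (z + π / 2 - w))
      (thetaCosD 0 t z * thetaCos 0 t (z + π / 2) -
        thetaCos 0 t z * thetaCosD 0 t (z + π / 2)) 0 := by
    have h1 := HasDerivAt.comp_const_add z 0 (by simpa using hasDerivAt_thetaCos 0 ht z)
    have h2 := HasDerivAt.comp_const_sub (z + π / 2) 0
      (by simpa using hasDerivAt_thetaCos 0 ht (z + π / 2))
    exact (h1.mul h2).congr_deriv (by simp; ring)
  have hin : HasDerivAt (fun w : ℝ => 2 * w - π / 2) 2 0 := by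
    simpa using ((hasDerivAt_id (0 : ℝ)).const_mul 2).sub_const (π / 2)
  have hr : ∀ a, HasDerivAt (fun w => thetaCos a (2 * t) (2 * w - π / 2))
      (thetaCosD a (2 * t) (-(π / 2)) * 2) 0 := fun a => by
    have := (hasDerivAt_thetaCos a ht2 (2 * 0 - π / 2)).comp (0 : ℝ) hin
    exact this.congr_deriv (by simp)
  rw [e] at hl
  have := hl.unique (((hr 0).const_mul _).add ((hr (1 / 2)).const_mul _))
  rw [this, thetaCos_half_mul_shift ht, thetaCosD_neg, thetaCosD_zero_apply_pi_div_two]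
  field_simp
  ring

lemma exists_theta_log_deriv {t : ℝ} (ht : 0 < t) :
    ∃ α β : ℝ, ∀ z, thetaCosDD 0 t z * thetaCos 0 t z - thetaCosD 0 t z ^ 2 =
        α * thetaCos 0 t z ^ 2 + β * thetaCos 0 t (z + π / 2) ^ 2 := by
  have ht2 : 0 < 2 * t := by positivity
  have hA := thetaCos_apply_zero_pos 0 ht2
  have hB := thetaCos_apply_zero_pos (1 / 2) ht2
  refine ⟨thetaCosDD 0 (2 * t) 0 / thetaCos 0 (2 * t) 0 +
      thetaCosDD (1 / 2) (2 * t) 0 / thetaCos (1 / 2) (2 * t) 0,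
    thetaCosDD 0 (2 * t) 0 / thetaCos 0 (2 * t) 0 -
      thetaCosDD (1 / 2) (2 * t) 0 / thetaCos (1 / 2) (2 * t) 0, fun z => ?_⟩
  have hlin : ∀ w : ℝ, HasDerivAt (fun w : ℝ => 2 * w) 2 w := fun w => by
    simpa using (hasDerivAt_id w).const_mul 2
  have e : (fun w => thetaCos 0 t (z + w) * thetaCos 0 t (z - w)) = fun w =>
      thetaCos 0 (2 * t) (2 * z) * thetaCos 0 (2 * t) (2 * w) +
        thetaCos (1 / 2) (2 * t) (2 * z) * thetaCos (1 / 2) (2 * t) (2 * w) := by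
    funext w
    rw [thetaCos_zero_mul ht]
    ring_nf
  have hl : ∀ w, HasDerivAt (fun w => thetaCos 0 t (z + w) * thetaCos 0 t (z - w))
      (thetaCosD 0 t (z + w) * thetaCos 0 t (z - w) +
        thetaCos 0 t (z + w) * -thetaCosD 0 t (z - w)) w := fun w =>
    ((hasDerivAt_thetaCos 0 ht (z + w)).comp_const_add z w).mul
      ((hasDerivAt_thetaCos 0 ht (z - w)).comp_const_sub z w)
  have hr : ∀ w, HasDerivAt (fun w =>
      thetaCos 0 (2 * t) (2 * z) * thetaCos 0 (2 * t) (2 * w) +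
        thetaCos (1 / 2) (2 * t) (2 * z) * thetaCos (1 / 2) (2 * t) (2 * w))
      (thetaCos 0 (2 * t) (2 * z) * (thetaCosD 0 (2 * t) (2 * w) * 2) +
        thetaCos (1 / 2) (2 * t) (2 * z) * (thetaCosD (1 / 2) (2 * t) (2 * w) * 2)) w := fun w =>
    (((hasDerivAt_thetaCos 0 ht2 (2 * w)).comp w (hlin w)).const_mul _).add
      (((hasDerivAt_thetaCos (1 / 2) ht2 (2 * w)).comp w (hlin w)).const_mul _)
  have e' := funext fun w => (e ▸ hl w).unique (hr w)
  have hl' := (((hasDerivAt_thetaCosD 0 ht (z + 0)).comp_const_add z 0).mul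
      ((hasDerivAt_thetaCos 0 ht (z - 0)).comp_const_sub z 0)).add
    (((hasDerivAt_thetaCos 0 ht (z + 0)).comp_const_add z 0).mul
      ((hasDerivAt_thetaCosD 0 ht (z - 0)).comp_const_sub z 0).neg)
  have hr' := ((((hasDerivAt_thetaCosD 0 ht2 (2 * 0)).comp 0 (hlin 0)).mul_const 2).const_mul
      (thetaCos 0 (2 * t) (2 * z))).add
    ((((hasDerivAt_thetaCosD (1 / 2) ht2 (2 * 0)).comp 0 (hlin 0)).mul_const 2).const_mul
      (thetaCos (1 / 2) (2 * t) (2 * z)))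
  have key := HasDerivAt.unique (f := fun w => thetaCosD 0 t (z + w) * thetaCos 0 t (z - w) +
        thetaCos 0 t (z + w) * -thetaCosD 0 t (z - w)) hl' (by rw [e']; exact hr')
  simp only [add_zero, sub_zero, mul_zero, Pi.neg_apply] at key
  rw [thetaCos_zero_sq ht, thetaCos_zero_add_sq ht]
  field_simp
  linear_combination (1 / 2) * key * thetaCos 0 (2 * t) 0 * thetaCos (1 / 2) (2 * t) 0

lemma hasSum_nat_thetaCos_half {t : ℝ} (ht : 0 < t) (z : ℝ) :
    HasSum (fun n : ℕ => 2 * (rexp (-π * (n + 1 / 2) ^ 2 * t) * cos ((2 * n + 1) * z)))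
      (thetaCos (1 / 2) t z) := by
  refine (summable_thetaCos (1 / 2) ht z).hasSum.nat_add_neg_add_one.congr_fun fun n => ?_
  push_cast
  rw [show -((n : ℝ) + 1) + 1 / 2 = -(n + 1 / 2) by ring, neg_sq,
    show 2 * -((n : ℝ) + 1 / 2) * z = -((2 * n + 1) * z) by ring, cos_neg,
    show 2 * ((n : ℝ) + 1 / 2) * z = (2 * n + 1) * z by ring]
  ring

lemma abs_sin_nat_mul_le (n : ℕ) (x : ℝ) : |sin (n * x)| ≤ n * |sin x| := by
  induction n with
  | zero => simp
  | succ n ih =>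
    rw [Nat.cast_succ, add_mul, one_mul, sin_add]
    calc |sin (n * x) * cos x + cos (n * x) * sin x|
        ≤ |sin (n * x)| * |cos x| + |cos (n * x)| * |sin x| := by
          rw [← abs_mul, ← abs_mul]; exact abs_add_le _ _
      _ ≤ (n * |sin x|) * 1 + 1 * |sin x| := by
          gcongr
          · exact abs_cos_le_one _
          · exact abs_cos_le_one _
      _ = (n + 1) * |sin x| := by ring

lemma abs_cos_odd_mul_le (n : ℕ) (x : ℝ) : |cos ((2 * n + 1) * x)| ≤ (2 * n + 1) * |cos x| := by
  have h := abs_sin_nat_mul_le (2 * n + 1) (x + π / 2)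
  rw [sin_add_pi_div_two] at h
  push_cast at h
  rwa [show (2 * (n : ℝ) + 1) * (x + π / 2) = (2 * n + 1) * x + π / 2 + n * π by ring,
    sin_add_nat_mul_pi, abs_mul, abs_pow, abs_neg, abs_one, one_pow, one_mul,
    sin_add_pi_div_two] at h

lemma thetaCos_half_pos_of_one_le {t : ℝ} (ht : 1 ≤ t) {z : ℝ} (hz : z ∈ Set.Ioo (-(π / 2)) (π / 2)) :
    0 < thetaCos (1 / 2) t z := by
  have hc : 0 < cos z := cos_pos_of_mem_Ioo hz
  have ht0 : 0 < t := by linarith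
  set q := rexp (-π * t) with hq
  have hq4 : q < 1 / 4 := by
    have h1 : q ≤ rexp (-3) := by
      apply exp_le_exp.2
      nlinarith [pi_gt_three]
    have h2 : rexp (-3) < 1 / 4 := by
      rw [exp_neg, one_div]
      apply inv_strictAnti₀ (by norm_num)
      have := add_one_lt_exp (x := 3) (by norm_num)
      linarith
    linarith
  have hq0 : 0 < q := exp_pos _
  set r := 3 * q ^ 2 with hr
  have hr0 : 0 ≤ r := by positivity
  have hr1 : r < 1 / 2 := by nlinarith
  set E := rexp (-π * (1 / 2) ^ 2 * t) with hE
  have hE0 : 0 < E := exp_pos _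
  have hterm : ∀ n : ℕ, rexp (-π * (n + 1 / 2) ^ 2 * t) * (2 * n + 1) ≤ E * r ^ n := by
    intro n
    have h1 : rexp (-π * (n + 1 / 2) ^ 2 * t) ≤ E * (q ^ 2) ^ n := by
      rw [hE, hq, ← exp_nat_mul, ← exp_nat_mul, ← exp_add]
      apply exp_le_exp.2
      have hn : (n : ℝ) ≤ n ^ 2 := by exact_mod_cast Nat.le_self_pow two_ne_zero n
      have := mul_le_mul_of_nonneg_left hn (mul_pos pi_pos ht0).le
      push_cast
      nlinarith
    have h2 : (2 * n + 1 : ℝ) ≤ 3 ^ n := by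
      have := one_add_mul_le_pow (a := (2 : ℝ)) (by norm_num) n
      norm_num at this
      linarith
    calc _ ≤ (E * (q ^ 2) ^ n) * 3 ^ n := by gcongr
      _ = E * r ^ n := by rw [hr, mul_pow]; ring
  have hg : HasSum (fun n : ℕ => 2 * (E * cos z) * ((if n = 0 then 2 else 0) - r ^ n))
      (2 * (E * cos z) * (2 - (1 - r)⁻¹)) :=
    ((hasSum_ite_eq 0 (2 : ℝ)).sub (hasSum_geometric_of_lt_one hr0 (by linarith))).mul_left _
  have hle := hasSum_le (fun n => ?_) hg (hasSum_nat_thetaCos_half ht0 z)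
  · refine lt_of_lt_of_le (mul_pos (by positivity) ?_) hle
    have : (1 - r)⁻¹ < 2 := by
      rw [inv_lt_comm₀ (by linarith) (by norm_num)]
      linarith
    linarith
  · rcases eq_or_ne n 0 with rfl | hn
    · simp [hE]
      norm_num
    · rw [if_neg hn]
      have h1 := abs_cos_odd_mul_le n z
      rw [abs_of_pos hc] at h1
      have h2 := neg_le_of_abs_le h1
      have h3 := mul_le_mul_of_nonneg_left h2 (exp_pos (-π * (n + 1 / 2) ^ 2 * t)).le
      have h4 := mul_le_mul_of_nonneg_right (hterm n) hc.le
      nlinarith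

lemma thetaCos_half_pos_of_double {t : ℝ} (ht : 0 < t)
    (h : ∀ z ∈ Set.Ioo (-(π / 2)) (π / 2), 0 < thetaCos (1 / 2) (2 * t) z) :
    ∀ z ∈ Set.Ioo (-(π / 2)) (π / 2), 0 < thetaCos (1 / 2) t z := by
  have hB := thetaCos_apply_zero_pos (1 / 2) ht
  have hne : ∀ z ∈ Set.Ico 0 (π / 2), thetaCos (1 / 2) t z ≠ 0 := by
    rintro z ⟨hz0, hz1⟩ h0
    rcases hz0.eq_or_lt with rfl | hz0
    · exact hB.ne' h0
    · have h1 := thetaCos_half_mul_shift ht z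
      rw [h0, zero_mul, show 2 * z + π / 2 = (2 * z - π / 2) + π by ring,
        thetaCos_half_add_pi] at h1
      have h2 := h (2 * z - π / 2) ⟨by linarith, by linarith⟩
      have h3 := thetaCos_zero_pos (by positivity : 0 < 2 * t) (π / 2)
      nlinarith [mul_pos h2 h3]
  have hpos : ∀ z ∈ Set.Ico 0 (π / 2), 0 < thetaCos (1 / 2) t z := by
    intro z hz
    by_contra hneg
    obtain ⟨w, hw, hw0⟩ := intermediate_value_Icc' hz.1 (continuous_thetaCos (1 / 2) ht).continuousOn
      ⟨not_lt.1 hneg, hB.le⟩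
    exact hne w ⟨hw.1, hw.2.trans_lt hz.2⟩ hw0
  intro z hz
  rcases le_total 0 z with h0 | h0
  · exact hpos z ⟨h0, hz.2⟩
  · rw [← thetaCos_neg]
    exact hpos (-z) ⟨by linarith, by linarith [hz.1]⟩

lemma thetaCos_half_pos {t : ℝ} (ht : 0 < t) {z : ℝ} (hz : z ∈ Set.Ioo (-(π / 2)) (π / 2)) :
    0 < thetaCos (1 / 2) t z := by
  have key : ∀ n : ℕ, ∀ t : ℝ, 0 < t → 1 ≤ 2 ^ n * t →
      ∀ z ∈ Set.Ioo (-(π / 2)) (π / 2), 0 < thetaCos (1 / 2) t z := by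
    intro n
    induction n with
    | zero => exact fun t _ h z hz => thetaCos_half_pos_of_one_le (by simpa using h) hz
    | succ n ih =>
      intro t ht h
      exact thetaCos_half_pos_of_double ht (ih (2 * t) (by positivity) (by rw [pow_succ] at h; linarith))
  obtain ⟨n, hn⟩ := pow_unbounded_of_one_lt (1 / t) one_lt_two
  exact key n t ht ((div_le_iff₀ ht).1 hn.le) z hz

/-- The modulus `θ₂² / θ₃²`. -/
noncomputable def thetaMod (t : ℝ) : ℝ := thetaCos (1 / 2) t 0 ^ 2 / thetaCos 0 t 0 ^ 2

/-- The complementary modulus `θ₄² / θ₃²`. -/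
noncomputable def thetaMod' (t : ℝ) : ℝ := thetaCos 0 t (π / 2) ^ 2 / thetaCos 0 t 0 ^ 2

/-- The scale `θ₃ θ₁' / (θ₂ θ₄)`, which turns out to be `2 K / π`. -/
noncomputable def thetaScale (t : ℝ) : ℝ :=
  -(thetaCos 0 t 0 * thetaCosD (1 / 2) t (π / 2)) /
    (thetaCos (1 / 2) t 0 * thetaCos 0 t (π / 2))

/-- The function `sn` in the theta variable. -/
noncomputable def thetaSn (t z : ℝ) : ℝ :=
  -(thetaCos 0 t 0 / thetaCos (1 / 2) t 0) *
    (thetaCos (1 / 2) t (z + π / 2) / thetaCos 0 t (z + π / 2))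

/-- The function `cn` in the theta variable. -/
noncomputable def thetaCn (t z : ℝ) : ℝ :=
  (thetaCos 0 t (π / 2) / thetaCos (1 / 2) t 0) *
    (thetaCos (1 / 2) t z / thetaCos 0 t (z + π / 2))

/-- The function `dn` in the theta variable. -/
noncomputable def thetaDn (t z : ℝ) : ℝ :=
  (thetaCos 0 t (π / 2) / thetaCos 0 t 0) * (thetaCos 0 t z / thetaCos 0 t (z + π / 2))

section

variable {t : ℝ}

lemma thetaMod_pos (ht : 0 < t) : 0 < thetaMod t :=
  div_pos (pow_pos (thetaCos_apply_zero_pos _ ht) 2) (pow_pos (thetaCos_apply_zero_pos _ ht) 2)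

lemma thetaMod'_pos (ht : 0 < t) : 0 < thetaMod' t :=
  div_pos (pow_pos (thetaCos_zero_pos ht _) 2) (pow_pos (thetaCos_apply_zero_pos _ ht) 2)

lemma thetaMod_sq_add (ht : 0 < t) : thetaMod t ^ 2 + thetaMod' t ^ 2 = 1 := by
  have h3 := thetaCos_apply_zero_pos 0 ht
  rw [thetaMod, thetaMod']
  field_simp
  linear_combination theta_jacobi_identity ht

lemma sqrt_one_sub_thetaMod_sq (ht : 0 < t) : √(1 - thetaMod t ^ 2) = thetaMod' t := by
  rw [← thetaMod_sq_add ht, add_sub_cancel_left, sqrt_sq (thetaMod'_pos ht).le]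

lemma thetaSn_sq_add_thetaCn_sq (ht : 0 < t) (z : ℝ) : thetaSn t z ^ 2 + thetaCn t z ^ 2 = 1 := by
  have h2 := thetaCos_apply_zero_pos (1 / 2) ht
  have h4 := thetaCos_zero_pos ht (z + π / 2)
  have h := theta_sn_cn ht z
  rw [thetaSn, thetaCn]
  generalize z + π / 2 = w at *
  field_simp
  linear_combination h

lemma thetaDn_sq_add (ht : 0 < t) (z : ℝ) :
    thetaDn t z ^ 2 + thetaMod t ^ 2 * thetaSn t z ^ 2 = 1 := by
  have h2 := thetaCos_apply_zero_pos (1 / 2) ht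
  have h3 := thetaCos_apply_zero_pos 0 ht
  have h4 := thetaCos_zero_pos ht (z + π / 2)
  have h := theta_dn_sn ht z
  rw [thetaSn, thetaDn, thetaMod]
  generalize z + π / 2 = w at *
  field_simp
  linear_combination h

lemma thetaDn_pos (ht : 0 < t) (z : ℝ) : 0 < thetaDn t z :=
  mul_pos (div_pos (thetaCos_zero_pos ht _) (thetaCos_zero_pos ht _))
    (div_pos (thetaCos_zero_pos ht _) (thetaCos_zero_pos ht _))

lemma thetaCn_pos (ht : 0 < t) {z : ℝ} (hz : z ∈ Set.Ioo (-(π / 2)) (π / 2)) : 0 < thetaCn t z :=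
  mul_pos (div_pos (thetaCos_zero_pos ht _) (thetaCos_apply_zero_pos _ ht))
    (div_pos (thetaCos_half_pos ht hz) (thetaCos_zero_pos ht _))

lemma thetaSn_pos (ht : 0 < t) {z : ℝ} (hz : z ∈ Set.Ioo 0 π) : 0 < thetaSn t z := by
  have h : thetaCos (1 / 2) t (z + π / 2) = -thetaCos (1 / 2) t (z - π / 2) := by
    rw [← thetaCos_half_add_pi]
    ring_nf
  rw [thetaSn, h, neg_div, neg_mul_neg]
  exact mul_pos (div_pos (thetaCos_zero_pos ht _) (thetaCos_apply_zero_pos _ ht))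
    (div_pos (thetaCos_half_pos ht ⟨by linarith [hz.1], by linarith [hz.2]⟩)
      (thetaCos_zero_pos ht _))

lemma thetaSn_apply_zero (t : ℝ) : thetaSn t 0 = 0 := by
  simp [thetaSn, -one_div, thetaCos_half_apply_pi_div_two]

lemma thetaCn_apply_zero (ht : 0 < t) : thetaCn t 0 = 1 := by
  have h2 := thetaCos_apply_zero_pos (1 / 2) ht
  have h4 := thetaCos_zero_pos ht (π / 2)
  rw [thetaCn, zero_add]
  field_simp

lemma thetaDn_apply_zero (ht : 0 < t) : thetaDn t 0 = 1 := by
  have h2 := thetaCos_apply_zero_pos 0 ht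
  have h4 := thetaCos_zero_pos ht (π / 2)
  rw [thetaDn, zero_add]
  field_simp

lemma thetaSn_apply_pi_div_two (ht : 0 < t) : thetaSn t (π / 2) = 1 := by
  have h2 := thetaCos_apply_zero_pos (1 / 2) ht
  have h3 := thetaCos_apply_zero_pos 0 ht
  have e0 := thetaCos_zero_add_pi t 0
  have e1 := thetaCos_half_add_pi t 0
  rw [zero_add] at e0 e1
  rw [thetaSn, add_halves, e0, e1]
  field_simp

lemma hasDerivAt_thetaCos_shift (a : ℝ) (ht : 0 < t) (z : ℝ) :
    HasDerivAt (fun z => thetaCos a t (z + π / 2)) (thetaCosD a t (z + π / 2)) z :=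
  (hasDerivAt_thetaCos a ht (z + π / 2)).comp_add_const z (π / 2)

/-- The derivative of `thetaSn` as it comes out of the quotient rule. -/
noncomputable def thetaSnD (t z : ℝ) : ℝ :=
  -(thetaCos 0 t 0 / thetaCos (1 / 2) t 0) *
    ((thetaCosD (1 / 2) t (z + π / 2) * thetaCos 0 t (z + π / 2) -
      thetaCos (1 / 2) t (z + π / 2) * thetaCosD 0 t (z + π / 2)) / thetaCos 0 t (z + π / 2) ^ 2)

lemma hasDerivAt_thetaSn_thetaSnD (ht : 0 < t) (z : ℝ) :
    HasDerivAt (thetaSn t) (thetaSnD t z) z :=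
  ((hasDerivAt_thetaCos_shift (1 / 2) ht z).div (hasDerivAt_thetaCos_shift 0 ht z)
    (thetaCos_zero_pos ht _).ne').const_mul _

lemma continuous_thetaSn (ht : 0 < t) : Continuous (thetaSn t) :=
  continuous_iff_continuousAt.2 fun z => (hasDerivAt_thetaSn_thetaSnD ht z).continuousAt

lemma differentiable_thetaCn (ht : 0 < t) : Differentiable ℝ (thetaCn t) := fun z =>
  (((hasDerivAt_thetaCos (1 / 2) ht z).div (hasDerivAt_thetaCos_shift 0 ht z)
    (thetaCos_zero_pos ht _).ne').const_mul _).differentiableAt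

lemma continuous_thetaSnD (ht : 0 < t) : Continuous (thetaSnD t) := by
  have h := fun a => (continuous_thetaCos a ht).comp (continuous_add_const (π / 2))
  have h' := fun a => (continuous_thetaCosD a ht).comp (continuous_add_const (π / 2))
  exact (((h' _).mul (h _)).sub ((h _).mul (h' _))).div ((h 0).pow 2)
    (fun z => (pow_pos (thetaCos_zero_pos ht _) 2).ne') |>.const_mul _

lemma exists_hasDerivAt_thetaDn (ht : 0 < t) :
    ∃ c : ℝ, ∀ z, HasDerivAt (thetaDn t) (-(c * thetaMod t ^ 2 * (thetaSn t z * thetaCn t z))) z := by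
  obtain ⟨c, hc⟩ := exists_theta_wronskian ht
  refine ⟨c / thetaMod t, fun z => ?_⟩
  refine (((hasDerivAt_thetaCos 0 ht z).div (hasDerivAt_thetaCos_shift 0 ht z)
    (thetaCos_zero_pos ht _).ne').const_mul _).congr_deriv ?_
  have h2 := thetaCos_apply_zero_pos (1 / 2) ht
  have h3 := thetaCos_apply_zero_pos 0 ht
  have h4 := thetaCos_zero_pos ht (z + π / 2)
  rw [hc, thetaMod, thetaSn, thetaCn]
  field_simp

lemma continuous_thetaDn (ht : 0 < t) : Continuous (thetaDn t) := by
  obtain ⟨c, hc⟩ := exists_hasDerivAt_thetaDn ht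
  exact continuous_iff_continuousAt.2 fun z => (hc z).continuousAt

lemma hasDerivAt_thetaDn_and_thetaSn (ht : 0 < t) :
    (∀ z, HasDerivAt (thetaDn t) (-(thetaScale t * thetaMod t ^ 2 * (thetaSn t z * thetaCn t z))) z) ∧
      ∀ z ∈ Set.Icc 0 (π / 2), HasDerivAt (thetaSn t) (thetaScale t * (thetaCn t z * thetaDn t z)) z := by
  obtain ⟨c, hc⟩ := exists_hasDerivAt_thetaDn ht
  have hk := thetaMod_pos ht
  have hIoo : Set.EqOn (thetaSnD t) (fun z => c * (thetaCn t z * thetaDn t z))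
      (Set.Ioo 0 (π / 2)) := by
    intro z hz
    have hs := thetaSn_pos ht ⟨hz.1, by linarith [hz.2, pi_pos]⟩
    have h1 := ((hc z).pow 2).add (((hasDerivAt_thetaSn_thetaSnD ht z).pow 2).const_mul (thetaMod t ^ 2))
    have e : (thetaDn t ^ 2 + fun z => thetaMod t ^ 2 * (thetaSn t ^ 2) z) = fun _ => (1 : ℝ) :=
      funext fun z => thetaDn_sq_add ht z
    rw [e] at h1
    have h2 := h1.unique (hasDerivAt_const z 1)
    have h3 : 2 * thetaMod t ^ 2 * thetaSn t z *
        (thetaSnD t z - c * (thetaCn t z * thetaDn t z)) = 0 := by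
      norm_num at h2
      linear_combination h2
    have := (mul_eq_zero.1 h3).resolve_left (by positivity)
    simpa using sub_eq_zero.1 this
  have hIcc : Set.EqOn (thetaSnD t) (fun z => c * (thetaCn t z * thetaDn t z))
      (Set.Icc 0 (π / 2)) := by
    refine hIoo.of_subset_closure (continuous_thetaSnD ht).continuousOn ?_ Set.Ioo_subset_Icc_self
      (closure_Ioo (by positivity)).ge
    exact (((differentiable_thetaCn ht).continuous.mul (continuous_thetaDn ht)).const_mul
      c).continuousOn
  have hcs : c = thetaScale t := by
    have h := hIcc (Set.left_mem_Icc.2 (by positivity))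
    simp only [thetaCn_apply_zero ht, thetaDn_apply_zero ht, mul_one] at h
    have h2 := thetaCos_apply_zero_pos (1 / 2) ht
    have h4 := thetaCos_zero_pos ht (π / 2)
    rw [← h, thetaSnD, thetaScale, zero_add, thetaCos_half_apply_pi_div_two]
    field_simp
    ring
  subst hcs
  exact ⟨hc, fun z hz => (hasDerivAt_thetaSn_thetaSnD ht z).congr_deriv (hIcc hz)⟩

lemma hasDerivAt_thetaDn (ht : 0 < t) (z : ℝ) :
    HasDerivAt (thetaDn t) (-(thetaScale t * thetaMod t ^ 2 * (thetaSn t z * thetaCn t z))) z :=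
  (hasDerivAt_thetaDn_and_thetaSn ht).1 z

lemma hasDerivAt_thetaSn (ht : 0 < t) {z : ℝ} (hz : z ∈ Set.Icc 0 (π / 2)) :
    HasDerivAt (thetaSn t) (thetaScale t * (thetaCn t z * thetaDn t z)) z :=
  (hasDerivAt_thetaDn_and_thetaSn ht).2 z hz

lemma log_deriv_sub (ht : 0 < t) (z : ℝ) :
    thetaCosD 0 t z / thetaCos 0 t z - thetaCosD 0 t (z + π / 2) / thetaCos 0 t (z + π / 2) =
      -(thetaScale t * thetaMod t ^ 2 * (thetaSn t z * thetaCn t z)) / thetaDn t z := by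
  have h := (((hasDerivAt_thetaCos 0 ht z).div (hasDerivAt_thetaCos_shift 0 ht z)
    (thetaCos_zero_pos ht _).ne').const_mul
      (thetaCos 0 t (π / 2) / thetaCos 0 t 0)).unique (hasDerivAt_thetaDn ht z)
  rw [← h, thetaDn]
  have h1 := thetaCos_zero_pos ht (z + π / 2)
  have h2 := thetaCos_zero_pos ht z
  have h3 := thetaCos_zero_pos ht 0
  have h4 := thetaCos_zero_pos ht (π / 2)
  clear h
  generalize z + π / 2 = w at *
  field_simp

lemma exists_hasDerivAt_log_deriv (ht : 0 < t) :
    ∃ α : ℝ, ∀ z, HasDerivAt (fun z => thetaCosD 0 t z / thetaCos 0 t z)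
      (α + thetaScale t ^ 2 * thetaMod' t ^ 2 / thetaDn t z ^ 2) z := by
  obtain ⟨α, β, hαβ⟩ := exists_theta_log_deriv ht
  have hk' := thetaMod'_pos ht
  have hk := thetaMod_pos ht
  have hd : ∀ z, HasDerivAt (fun z => thetaCosD 0 t z / thetaCos 0 t z)
      (α + β * (thetaCos 0 t (z + π / 2) ^ 2 / thetaCos 0 t z ^ 2)) z := fun z => by
    have hz := thetaCos_zero_pos ht z
    refine ((hasDerivAt_thetaCosD 0 ht z).div (hasDerivAt_thetaCos 0 ht z) hz.ne').congr_deriv ?_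
    rw [← sq, hαβ]
    field_simp
  have hβ : β = thetaScale t ^ 2 * thetaMod' t := by
    have h1 := (hd 0).sub ((hd (0 + π / 2)).comp_add_const 0 (π / 2))
    have e := funext (log_deriv_sub ht)
    have h2 := (((hasDerivAt_thetaSn ht (Set.left_mem_Icc.2 (by positivity))).mul
      (differentiable_thetaCn ht 0).hasDerivAt).const_mul
        (thetaScale t * thetaMod t ^ 2)).neg.div (hasDerivAt_thetaDn ht 0) (thetaDn_pos ht 0).ne'
    have h3 := h1.unique (f := fun z => thetaCosD 0 t z / thetaCos 0 t z -
      thetaCosD 0 t (z + π / 2) / thetaCos 0 t (z + π / 2)) (by rw [e]; exact h2)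
    have e0 := thetaCos_zero_add_pi t 0
    simp only [zero_add, add_halves] at h3 e0
    simp [thetaSn_apply_zero, thetaCn_apply_zero ht, thetaDn_apply_zero ht, e0] at h3
    have p3 := thetaCos_zero_pos ht 0
    have p4 := thetaCos_zero_pos ht (π / 2)
    have h4 : β * (thetaMod' t ^ 2 - 1) = -(thetaScale t ^ 2 * thetaMod t ^ 2) * thetaMod' t := by
      rw [thetaMod']
      field_simp at h3 ⊢
      exact h3
    have h5 := thetaMod_sq_add ht
    have : thetaMod t ^ 2 * (β - thetaScale t ^ 2 * thetaMod' t) = 0 := by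
      linear_combination -h4 + β * h5
    exact sub_eq_zero.1 ((mul_eq_zero.1 this).resolve_left (by positivity))
  refine ⟨α, fun z => (hd z).congr_deriv ?_⟩
  have h1 := thetaCos_zero_pos ht (z + π / 2)
  have h2 := thetaCos_zero_pos ht z
  have h3 := thetaCos_zero_pos ht 0
  have h4 := thetaCos_zero_pos ht (π / 2)
  rw [hβ, thetaMod', thetaDn]
  field_simp

lemma EllK_thetaMod (ht : 0 < t) : EllK (thetaMod t) = thetaScale t * (π / 2) := by
  have hp : (0 : ℝ) < π / 2 := by positivity
  have hk := thetaMod_pos ht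
  have hk1 : thetaMod t ^ 2 < 1 := by nlinarith [thetaMod_sq_add ht, thetaMod'_pos ht]
  have hs0 : ∀ z ∈ Set.Ioo 0 (π / 2), HasDerivAt (fun z => arcsin (thetaSn t z))
      (thetaScale t * thetaDn t z) z := by
    intro z hz
    have hs := thetaSn_pos ht ⟨hz.1, by linarith [hz.2]⟩
    have hc := thetaCn_pos ht ⟨by linarith [hz.1], hz.2⟩
    have hsc := thetaSn_sq_add_thetaCn_sq ht z
    have h1 : thetaSn t z < 1 := by nlinarith
    refine ((hasDerivAt_arcsin (by linarith) h1.ne).comp z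
      (hasDerivAt_thetaSn ht (Set.Ioo_subset_Icc_self hz))).congr_deriv ?_
    rw [show 1 - thetaSn t z ^ 2 = thetaCn t z ^ 2 by linarith, sqrt_sq hc.le]
    field_simp
  have hsub := intervalIntegral.integral_comp_mul_deriv'' (a := 0) (b := π / 2)
    (f := fun z => arcsin (thetaSn t z)) (f' := fun z => thetaScale t * thetaDn t z)
    (g := fun θ => 1 / √(1 - thetaMod t ^ 2 * sin θ ^ 2))
    (continuous_arcsin.comp (continuous_thetaSn ht)).continuousOn
    (fun z hz => (hs0 z (by simpa [hp.le] using hz)).hasDerivWithinAt)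
    ((continuous_thetaDn ht).const_mul _).continuousOn
    (Continuous.continuousOn (by
      refine continuous_const.div (by fun_prop) fun θ => (sqrt_pos.2 ?_).ne'
      nlinarith [sin_sq_le_one θ, sq_nonneg (sin θ)]))
  rw [thetaSn_apply_zero, thetaSn_apply_pi_div_two ht, arcsin_zero, arcsin_one] at hsub
  rw [EllK, ← hsub]
  have hconst : ∀ z ∈ Set.uIcc 0 (π / 2),
      ((fun θ => 1 / √(1 - thetaMod t ^ 2 * sin θ ^ 2)) ∘ fun z => arcsin (thetaSn t z)) z *
        (thetaScale t * thetaDn t z) = thetaScale t := by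
    intro z _
    have hsc := thetaSn_sq_add_thetaCn_sq ht z
    have hd := thetaDn_pos ht z
    have h1 : thetaSn t z ^ 2 ≤ 1 := by nlinarith [sq_nonneg (thetaCn t z)]
    have h2 := abs_le.1 ((sq_le_one_iff_abs_le_one _).1 h1)
    simp only [Function.comp]
    rw [sin_arcsin h2.1 h2.2, show 1 - thetaMod t ^ 2 * thetaSn t z ^ 2 = thetaDn t z ^ 2 by
      linarith [thetaDn_sq_add ht z], sqrt_sq hd.le]
    field_simp
  rw [intervalIntegral.integral_congr hconst, intervalIntegral.integral_const]
  simp [mul_comm]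

end

lemma hasSum_nat_thetaCosD_half {t : ℝ} (ht : 0 < t) :
    HasSum (fun n : ℕ => 2 * (2 * n + 1) * (-1) ^ n * rexp (-π * (n + 1 / 2) ^ 2 * t))
      (-thetaCosD (1 / 2) t (π / 2)) := by
  refine (summable_thetaCosD (1 / 2) ht (π / 2)).hasSum.neg.nat_add_neg_add_one.congr_fun
    fun n => ?_
  have h : sin (n * π + π / 2) = (-1) ^ n := by rw [sin_add_pi_div_two, cos_nat_mul_pi]
  push_cast
  rw [show -((n : ℝ) + 1) + 1 / 2 = -(n + 1 / 2) by ring, neg_sq,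
    show 2 * -((n : ℝ) + 1 / 2) * (π / 2) = -(n * π + π / 2) by ring, sin_neg,
    show 2 * ((n : ℝ) + 1 / 2) * (π / 2) = n * π + π / 2 by ring, h]
  ring

lemma neg_thetaCosD_half_eq_sinKernel {t : ℝ} (ht : 0 < t) :
    -thetaCosD (1 / 2) t (π / 2) = sinKernel ((1 / 4 : ℝ) : UnitAddCircle) (t / 4) := by
  have h := hasSum_nat_sinKernel (1 / 4) (show 0 < t / 4 by positivity)
  refine HasSum.unique ?_ h
  rw [← zero_add (-thetaCosD (1 / 2) t (π / 2))]
  refine HasSum.even_add_odd ?_ ?_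
  · convert hasSum_zero using 2 with n
    push_cast
    rw [show 2 * π * (1 / 4) * (2 * (n : ℝ)) = n * π by ring, sin_nat_mul_pi]
    ring
  · refine (hasSum_nat_thetaCosD_half ht).congr_fun fun n => ?_
    push_cast
    rw [show 2 * π * (1 / 4) * (2 * (n : ℝ) + 1) = n * π + π / 2 by ring, sin_add_pi_div_two,
      cos_nat_mul_pi, show -π * (2 * (n : ℝ) + 1) ^ 2 * (t / 4) = -π * (n + 1 / 2) ^ 2 * t by ring]

lemma neg_thetaCosD_half_eq_oddKernel {t : ℝ} (ht : 0 < t) :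
    -thetaCosD (1 / 2) t (π / 2) = 8 * oddKernel ((1 / 4 : ℝ) : UnitAddCircle) (4 * t) := by
  have h := (hasSum_int_oddKernel (1 / 4) (show 0 < 4 * t by positivity)).nat_add_neg_add_one
  have hD := hasSum_nat_thetaCosD_half ht
  set f : ℕ → ℝ := fun n => 2 * (2 * n + 1) * (-1) ^ n * rexp (-π * (n + 1 / 2) ^ 2 * t) with hf
  have he : Summable fun n => f (2 * n) :=
    hD.summable.comp_injective fun m n h => by simpa using h
  have ho : Summable fun n => f (2 * n + 1) :=
    hD.summable.comp_injective fun m n h => by simpa using h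
  rw [← (he.hasSum.even_add_odd ho.hasSum).unique hD]
  refine (he.hasSum.add ho.hasSum).unique ((h.mul_left 8).congr_fun fun n => ?_)
  simp only [hf]
  push_cast
  rw [show -π * ((n : ℝ) + 1 / 4) ^ 2 * (4 * t) = -π * (2 * n + 1 / 2) ^ 2 * t by ring,
    show -π * (-((n : ℝ) + 1) + 1 / 4) ^ 2 * (4 * t) = -π * (2 * n + 1 + 1 / 2) ^ 2 * t by ring,
    (even_two_mul n).neg_one_pow, (odd_two_mul_add_one n).neg_one_pow]
  ring

section

variable {t : ℝ}

lemma thetaCosD_half_one_div (ht : 0 < t) :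
    thetaCosD (1 / 2) (1 / t) (π / 2) = t * √t * thetaCosD (1 / 2) t (π / 2) := by
  have h1 := neg_thetaCosD_half_eq_sinKernel (one_div_pos.2 ht)
  have h2 := neg_thetaCosD_half_eq_oddKernel ht
  rw [oddKernel_functional_equation] at h2
  rw [show 1 / t / 4 = 1 / (4 * t) by field_simp] at h1
  rw [← h1] at h2
  have h4 : (4 * t) ^ (3 / 2 : ℝ) = 8 * (t * √t) := by
    rw [mul_rpow (by norm_num) ht.le, show (4 : ℝ) = 2 ^ (2 : ℝ) by norm_num,
      ← rpow_mul (by norm_num), show (3 / 2 : ℝ) = 1 + 1 / 2 by norm_num, rpow_add ht, rpow_one,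
      ← sqrt_eq_rpow]
    norm_num
  rw [h4] at h2
  have := sqrt_pos.2 ht
  field_simp at h2
  linarith

lemma thetaCos_apply_zero_eq_cosKernel (a : ℝ) (ht : 0 < t) :
    thetaCos a t 0 = 1 / √t * thetaCos 0 (1 / t) (a * π) := by
  rw [thetaCos_apply_zero_eq_evenKernel _ ht, evenKernel_functional_equation, ← sqrt_eq_rpow,
    thetaCos_zero_eq_cosKernel (one_div_pos.2 ht), mul_div_cancel_right₀ _ pi_ne_zero]

lemma thetaCos_zero_one_div (ht : 0 < t) : thetaCos 0 (1 / t) 0 = √t * thetaCos 0 t 0 := by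
  have := sqrt_pos.2 ht
  rw [thetaCos_apply_zero_eq_cosKernel 0 ht, zero_mul]
  field_simp

lemma thetaCos_zero_one_div_pi_div_two (ht : 0 < t) :
    thetaCos 0 (1 / t) (π / 2) = √t * thetaCos (1 / 2) t 0 := by
  have := sqrt_pos.2 ht
  rw [thetaCos_apply_zero_eq_cosKernel (1 / 2) ht, show 1 / 2 * π = π / 2 by ring, ← mul_assoc,
    mul_one_div_cancel this.ne', one_mul]

lemma thetaCos_half_one_div (ht : 0 < t) :
    thetaCos (1 / 2) (1 / t) 0 = √t * thetaCos 0 t (π / 2) := by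
  have h := thetaCos_zero_one_div_pi_div_two (one_div_pos.2 ht)
  have := sqrt_pos.2 ht
  rw [one_div_one_div, sqrt_div zero_le_one, sqrt_one] at h
  rw [h]
  field_simp

lemma thetaMod_one_div (ht : 0 < t) : thetaMod (1 / t) = thetaMod' t := by
  have := sqrt_pos.2 ht
  rw [thetaMod, thetaMod', thetaCos_half_one_div ht, thetaCos_zero_one_div ht]
  field_simp

lemma thetaScale_one_div (ht : 0 < t) : thetaScale (1 / t) = t * thetaScale t := by
  have := sqrt_pos.2 ht
  rw [thetaScale, thetaScale, thetaCos_half_one_div ht, thetaCos_zero_one_div ht,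
    thetaCos_zero_one_div_pi_div_two ht, thetaCosD_half_one_div ht]
  have h2 := thetaCos_apply_zero_pos (1 / 2) ht
  have h4 := thetaCos_zero_pos ht (π / 2)
  field_simp

lemma EllK'_thetaMod (ht : 0 < t) : EllK' (thetaMod t) = t * EllK (thetaMod t) := by
  rw [EllK', sqrt_one_sub_thetaMod_sq ht, ← thetaMod_one_div ht, EllK_thetaMod (one_div_pos.2 ht),
    EllK_thetaMod ht, thetaScale_one_div ht, mul_assoc]

lemma thetaMod_sq_lt_one (ht : 0 < t) : thetaMod t ^ 2 < 1 := by
  nlinarith [thetaMod_sq_add ht, thetaMod'_pos ht]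

lemma EllK_pos {k : ℝ} (hk : k ^ 2 < 1) : 0 < EllK k := by
  have h : ∀ θ : ℝ, 0 < √(1 - k ^ 2 * sin θ ^ 2) := fun θ =>
    sqrt_pos.2 (by nlinarith [sin_sq_le_one θ, sq_nonneg (sin θ)])
  refine intervalIntegral.intervalIntegral_pos_of_pos (Continuous.intervalIntegrable ?_ _ _)
    (fun θ => one_div_pos.2 (h θ)) (by positivity)
  exact continuous_const.div (by fun_prop) fun θ => (h θ).ne'

lemma thetaScale_pos (ht : 0 < t) : 0 < thetaScale t := by
  have h := EllK_pos (thetaMod_sq_lt_one ht)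
  rw [EllK_thetaMod ht] at h
  exact pos_of_mul_pos_left h (by positivity)

lemma nome_thetaMod (ht : 0 < t) : nome (thetaMod t) = rexp (-π * t) := by
  have h := EllK_pos (thetaMod_sq_lt_one ht)
  rw [nome, EllK'_thetaMod ht]
  field_simp

end

lemma continuousOn_thetaMod : ContinuousOn thetaMod (Set.Ioi 0) := by
  have h : ∀ a : ℝ, ContinuousOn (fun t => thetaCos a t 0) (Set.Ioi 0) := fun a =>
    (continuousOn_evenKernel a).congr fun t ht => thetaCos_apply_zero_eq_evenKernel a ht
  exact ((h _).pow 2).div ((h _).pow 2) fun t ht => (pow_pos (thetaCos_zero_pos ht _) 2).ne'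

open Filter Topology in
lemma tendsto_of_isBigO_exp {f : ℝ → ℝ} {c : ℝ}
    (h : ∃ p, 0 < p ∧ (fun x => f x - c) =O[atTop] fun x => rexp (-p * x)) :
    Tendsto f atTop (𝓝 c) := by
  obtain ⟨p, hp, h⟩ := h
  have h0 : Tendsto (fun x => rexp (-p * x)) atTop (𝓝 0) :=
    tendsto_exp_atBot.comp (tendsto_id.const_mul_atTop_of_neg (neg_neg_of_pos hp))
  simpa using (h.trans_tendsto h0).add_const c

open Filter Topology in
lemma tendsto_thetaCos_zero_apply_zero : Tendsto (fun t => thetaCos 0 t 0) atTop (𝓝 1) := by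
  have h := tendsto_of_isBigO_exp (isBigO_atTop_cosKernel_sub 0)
  refine h.congr' ?_
  filter_upwards [eventually_gt_atTop 0] with t ht
  simp [thetaCos_zero_eq_cosKernel ht]

open Filter Topology in
lemma tendsto_thetaCos_half_apply_zero : Tendsto (fun t => thetaCos (1 / 2) t 0) atTop (𝓝 0) := by
  have h0 : ((1 / 2 : ℝ) : UnitAddCircle) ≠ 0 := by
    rw [Ne, AddCircle.coe_eq_zero_iff_of_mem_Ico (by norm_num)]
    norm_num
  have h := tendsto_of_isBigO_exp (isBigO_atTop_evenKernel_sub ((1 / 2 : ℝ) : UnitAddCircle))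
  rw [if_neg h0] at h
  refine h.congr' ?_
  filter_upwards [eventually_gt_atTop 0] with t ht
  exact (thetaCos_apply_zero_eq_evenKernel _ ht).symm

open Filter Topology in
lemma tendsto_thetaMod : Tendsto thetaMod atTop (𝓝 0) := by
  have := (tendsto_thetaCos_half_apply_zero.pow 2).div
    (tendsto_thetaCos_zero_apply_zero.pow 2) (by norm_num)
  rwa [zero_pow two_ne_zero, zero_div] at this

open Filter Topology in
lemma exists_thetaMod_eq {k : ℝ} (hk : k ∈ Set.Ioo (0 : ℝ) 1) : ∃ t, 0 < t ∧ thetaMod t = k := by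
  obtain ⟨a, ha0, ha⟩ := ((eventually_gt_atTop (0 : ℝ)).and
    (tendsto_thetaMod.eventually (gt_mem_nhds hk.1))).exists
  have hk1 : 0 < √(1 - k ^ 2) := sqrt_pos.2 (by nlinarith [hk.1, hk.2])
  obtain ⟨b, hb0, hb⟩ := ((eventually_gt_atTop (0 : ℝ)).and
    (tendsto_thetaMod.eventually (gt_mem_nhds hk1))).exists
  have hb' : k < thetaMod (1 / b) := by
    rw [thetaMod_one_div hb0]
    have h1 := thetaMod_sq_add hb0
    have h2 := pow_lt_pow_left₀ hb (thetaMod_pos hb0).le two_ne_zero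
    rw [sq_sqrt (by nlinarith [hk.1, hk.2])] at h2
    exact lt_of_pow_lt_pow_left₀ 2 (thetaMod'_pos hb0).le (by linarith)
  obtain ⟨t, ht, h⟩ := isPreconnected_Ioi.intermediate_value (Set.mem_Ioi.2 ha0)
    (Set.mem_Ioi.2 (one_div_pos.2 hb0)) continuousOn_thetaMod ⟨ha.le, hb'.le⟩
  exact ⟨t, ht, h⟩

lemma hasSum_nat_thetaCos_zero {t : ℝ} (ht : 0 < t) (z : ℝ) :
    HasSum (fun n : ℕ => 2 * (rexp (-π * (n + 1) ^ 2 * t) * cos (2 * (n + 1) * z)))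
      (thetaCos 0 t z - 1) := by
  rw [thetaCos_zero_eq_cosKernel ht]
  refine (hasSum_nat_cosKernel₀ (z / π) ht).congr_fun fun n => ?_
  rw [show 2 * π * (z / π) * ((n : ℝ) + 1) = 2 * (n + 1) * z by field_simp]
  ring

section

variable {t : ℝ}

lemma nome_thetaMod_pow (ht : 0 < t) (n : ℕ) :
    nome (thetaMod t) ^ ((n + 1) ^ 2) = rexp (-π * (n + 1) ^ 2 * t) := by
  rw [nome_thetaMod ht, ← exp_nat_mul]
  push_cast
  ring_nf

lemma nome_thetaMod_rpow (ht : 0 < t) (n : ℕ) :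
    nome (thetaMod t) ^ (((n : ℝ) + 1 / 2) ^ 2) = rexp (-π * (n + 1 / 2) ^ 2 * t) := by
  rw [nome_thetaMod ht, ← exp_mul]
  ring_nf

lemma JTheta1_thetaMod (ht : 0 < t) (u : ℝ) :
    JTheta1 u (thetaMod t) = thetaCos 0 t (u / thetaScale t) := by
  have hl := thetaScale_pos ht
  have h := (hasSum_nat_thetaCos_zero ht (u / thetaScale t)).tsum_eq
  rw [tsum_mul_left] at h
  rw [JTheta1, sub_eq_iff_eq_add'.1 h.symm]
  congr 2
  refine tsum_congr fun n => ?_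
  rw [nome_thetaMod_pow ht, EllK_thetaMod ht]
  congr 2
  field_simp

lemma JTheta_thetaMod (ht : 0 < t) (u : ℝ) :
    JTheta u (thetaMod t) = thetaCos 0 t (u / thetaScale t + π / 2) := by
  have hl := thetaScale_pos ht
  have h := (hasSum_nat_thetaCos_zero ht (u / thetaScale t + π / 2)).tsum_eq
  rw [tsum_mul_left] at h
  rw [JTheta, sub_eq_iff_eq_add'.1 h.symm]
  congr 2
  refine tsum_congr fun n => ?_
  have hc : cos (2 * (n + 1) * (u / thetaScale t + π / 2)) =
      (-1) ^ (n + 1) * cos (2 * (n + 1) * (u / thetaScale t)) := by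
    rw [← cos_add_nat_mul_pi]
    push_cast
    ring_nf
  rw [nome_thetaMod_pow ht, EllK_thetaMod ht, hc,
    show ((n : ℝ) + 1) * π * u / (thetaScale t * (π / 2)) = 2 * (n + 1) * (u / thetaScale t) by
      field_simp]
  ring

lemma JH1_thetaMod (ht : 0 < t) (u : ℝ) :
    JH1 u (thetaMod t) = thetaCos (1 / 2) t (u / thetaScale t) := by
  have hl := thetaScale_pos ht
  rw [JH1, ← (hasSum_nat_thetaCos_half ht (u / thetaScale t)).tsum_eq, tsum_mul_left]
  congr 1
  refine tsum_congr fun n => ?_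
  rw [nome_thetaMod_rpow ht, EllK_thetaMod ht]
  congr 2
  field_simp

lemma JH_thetaMod (ht : 0 < t) (u : ℝ) :
    JH u (thetaMod t) = -thetaCos (1 / 2) t (u / thetaScale t + π / 2) := by
  have hl := thetaScale_pos ht
  rw [JH, ← (hasSum_nat_thetaCos_half ht (u / thetaScale t + π / 2)).tsum_eq, tsum_mul_left,
    ← mul_neg, ← tsum_neg]
  congr 1
  refine tsum_congr fun n => ?_
  have hc : cos ((2 * n + 1) * (u / thetaScale t + π / 2)) =
      -((-1) ^ n * sin ((2 * n + 1) * (u / thetaScale t))) := by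
    rw [← sin_add_nat_mul_pi, ← cos_add_pi_div_two]
    ring_nf
  rw [nome_thetaMod_rpow ht, EllK_thetaMod ht, hc,
    show (2 * (n : ℝ) + 1) * π * u / (2 * (thetaScale t * (π / 2))) =
      (2 * n + 1) * (u / thetaScale t) by field_simp]
  ring

lemma sqrt_thetaMod (ht : 0 < t) : √(thetaMod t) = thetaCos (1 / 2) t 0 / thetaCos 0 t 0 := by
  have h := div_pos (thetaCos_apply_zero_pos (1 / 2) ht) (thetaCos_apply_zero_pos 0 ht)
  rw [thetaMod, ← div_pow, sqrt_sq h.le]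

lemma sqrt_thetaMod' (ht : 0 < t) : √(thetaMod' t) = thetaCos 0 t (π / 2) / thetaCos 0 t 0 := by
  have h := div_pos (thetaCos_zero_pos ht (π / 2)) (thetaCos_apply_zero_pos 0 ht)
  rw [thetaMod', ← div_pow, sqrt_sq h.le]

lemma sn_thetaMod (ht : 0 < t) (u : ℝ) : sn u (thetaMod t) = thetaSn t (u / thetaScale t) := by
  rw [sn, JH_thetaMod ht, JTheta_thetaMod ht, sqrt_thetaMod ht, thetaSn]
  have h2 := thetaCos_apply_zero_pos (1 / 2) ht
  have h3 := thetaCos_apply_zero_pos 0 ht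
  have h4 := thetaCos_zero_pos ht (u / thetaScale t + π / 2)
  generalize u / thetaScale t + π / 2 = w at *
  field_simp

lemma cn_thetaMod (ht : 0 < t) (u : ℝ) : cn u (thetaMod t) = thetaCn t (u / thetaScale t) := by
  rw [cn, JH1_thetaMod ht, JTheta_thetaMod ht, sqrt_one_sub_thetaMod_sq ht,
    sqrt_div (thetaMod'_pos ht).le, sqrt_thetaMod' ht, sqrt_thetaMod ht, thetaCn,
    div_div_div_cancel_right₀ (thetaCos_apply_zero_pos 0 ht).ne', mul_div_assoc]

lemma dn_thetaMod (ht : 0 < t) (u : ℝ) : dn u (thetaMod t) = thetaDn t (u / thetaScale t) := by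
  rw [dn, JTheta1_thetaMod ht, JTheta_thetaMod ht, sqrt_one_sub_thetaMod_sq ht,
    sqrt_thetaMod' ht, thetaDn, mul_div_assoc]

lemma zn_thetaMod (ht : 0 < t) (u : ℝ) :
    zn u (thetaMod t) = thetaCosD 0 t (u / thetaScale t + π / 2) /
      thetaCos 0 t (u / thetaScale t + π / 2) / thetaScale t := by
  have h : HasDerivAt (fun v => thetaCos 0 t (v / thetaScale t + π / 2))
      (thetaCosD 0 t (u / thetaScale t + π / 2) * (1 / thetaScale t)) u :=
    (hasDerivAt_thetaCos_shift 0 ht _).comp u ((hasDerivAt_id u).div_const (thetaScale t))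
  rw [zn, funext (JTheta_thetaMod ht), h.deriv, JTheta_thetaMod ht]
  ring

lemma jacobi_sub_zn_thetaMod (ht : 0 < t) (u : ℝ) :
    thetaMod t ^ 2 * sn u (thetaMod t) * cn u (thetaMod t) / dn u (thetaMod t) -
      zn u (thetaMod t) =
    -(thetaCosD 0 t (u / thetaScale t) / thetaCos 0 t (u / thetaScale t)) / thetaScale t := by
  have hl := thetaScale_pos ht
  have h := log_deriv_sub ht (u / thetaScale t)
  rw [sub_eq_iff_eq_add] at h
  rw [sn_thetaMod ht, cn_thetaMod ht, dn_thetaMod ht, zn_thetaMod ht, h]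
  have hd := thetaDn_pos ht (u / thetaScale t)
  generalize u / thetaScale t = z at *
  generalize thetaCosD 0 t (z + π / 2) / thetaCos 0 t (z + π / 2) = x
  field_simp
  ring

lemma deriv_deriv_log_deriv (ht : 0 < t) (u : ℝ) :
    deriv (deriv fun u => -(thetaCosD 0 t (u / thetaScale t) /
      thetaCos 0 t (u / thetaScale t)) / thetaScale t) u =
    -(2 * thetaMod t ^ 2 * thetaMod' t ^ 2 * thetaSn t (u / thetaScale t) *
      thetaCn t (u / thetaScale t) / thetaDn t (u / thetaScale t) ^ 3) := by
  have hl := thetaScale_pos ht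
  obtain ⟨α, hα⟩ := exists_hasDerivAt_log_deriv ht
  have hdiv : ∀ u, HasDerivAt (fun u => u / thetaScale t) (1 / thetaScale t) u := fun u =>
    (hasDerivAt_id u).div_const _
  have h1 : (deriv fun u => -(thetaCosD 0 t (u / thetaScale t) /
      thetaCos 0 t (u / thetaScale t)) / thetaScale t) = fun u =>
      -((α + thetaScale t ^ 2 * thetaMod' t ^ 2 / thetaDn t (u / thetaScale t) ^ 2) *
        (1 / thetaScale t)) / thetaScale t :=
    funext fun u => (((hα _).comp u (hdiv u)).neg.div_const _).deriv
  have hd := thetaDn_pos ht (u / thetaScale t)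
  have h2 := ((((((hasDerivAt_thetaDn ht _).comp u (hdiv u)).pow 2).fun_inv
    (pow_pos hd 2).ne').const_mul (thetaScale t ^ 2 * thetaMod' t ^ 2)).const_add α).mul_const
      (1 / thetaScale t) |>.neg.div_const (thetaScale t)
  rw [h1]
  refine (h2.congr_deriv ?_).deriv
  simp only [Function.comp, Pi.pow_apply]
  field_simp
  ring

end

theorem stmt_18 (k : ℝ) (hk : k ∈ Set.Ioo (0:ℝ) 1) :
    (fun u => k^2 * sn u k * cn u k / dn u k - zn u k) 0 = 0 ∧
    (fun u => k^2 * sn u k * cn u k / dn u k - zn u k) (EllK k) = 0 ∧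
    (∀ u ∈ Set.Ioo 0 (EllK k),
      0 < k^2 * sn u k * cn u k / dn u k - zn u k) ∧
    (∀ u ∈ Set.Ioo 0 (EllK k),
      deriv (deriv (fun w => k^2 * sn w k * cn w k / dn w k - zn w k)) u =
        -(2 * k^2 * Real.sqrt (1 - k^2) ^ 2 * sn u k * cn u k / dn u k ^ 3) ∧
      -(2 * k^2 * Real.sqrt (1 - k^2) ^ 2 * sn u k * cn u k / dn u k ^ 3) < 0) := by
  obtain ⟨t, ht, rfl⟩ := exists_thetaMod_eq hk
  have hl := thetaScale_pos ht
  have hK := EllK_thetaMod ht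
  have hKpos : 0 < EllK (thetaMod t) := hK ▸ by positivity
  set h : ℝ → ℝ := fun u => thetaMod t ^ 2 * sn u (thetaMod t) * cn u (thetaMod t) /
    dn u (thetaMod t) - zn u (thetaMod t) with hdef
  have heq := funext (jacobi_sub_zn_thetaMod ht)
  rw [← hdef] at heq
  have h0 : h 0 = 0 := by
    rw [heq]
    simp [thetaCosD_apply_zero]
  have h1 : h (EllK (thetaMod t)) = 0 := by
    rw [heq, hK]
    simp only [mul_div_cancel_left₀ _ hl.ne']
    simp [thetaCosD_zero_apply_pi_div_two]
  have hneg : ∀ u ∈ Set.Ioo 0 (EllK (thetaMod t)),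
      deriv (deriv h) u = -(2 * thetaMod t ^ 2 * √(1 - thetaMod t ^ 2) ^ 2 * sn u (thetaMod t) *
        cn u (thetaMod t) / dn u (thetaMod t) ^ 3) ∧
      -(2 * thetaMod t ^ 2 * √(1 - thetaMod t ^ 2) ^ 2 * sn u (thetaMod t) *
        cn u (thetaMod t) / dn u (thetaMod t) ^ 3) < 0 := by
    intro u hu
    have hz0 : 0 < u / thetaScale t := div_pos hu.1 hl
    have hz1 : u / thetaScale t < π / 2 := (div_lt_iff₀' hl).2 (hK ▸ hu.2)
    rw [sqrt_one_sub_thetaMod_sq ht, sn_thetaMod ht, cn_thetaMod ht, dn_thetaMod ht]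
    refine ⟨by rw [heq, deriv_deriv_log_deriv ht], ?_⟩
    have hs := thetaSn_pos ht ⟨hz0, by linarith [pi_pos]⟩
    have hc := thetaCn_pos ht ⟨by linarith [pi_pos], hz1⟩
    have hd := thetaDn_pos ht (u / thetaScale t)
    have hm := thetaMod_pos ht
    have hm' := thetaMod'_pos ht
    exact neg_neg_of_pos (by positivity)
  refine ⟨h0, h1, fun u hu => ?_, hneg⟩
  have hcont : Continuous h := by
    rw [heq]
    have hdiv : Continuous fun u => u / thetaScale t := continuous_id.div_const _
    exact ((((continuous_thetaCosD 0 ht).comp hdiv).div ((continuous_thetaCos 0 ht).comp hdiv)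
      fun u => (thetaCos_zero_pos ht _).ne').neg).div_const _
  have hconc : StrictConcaveOn ℝ (Set.Icc 0 (EllK (thetaMod t))) h :=
    strictConcaveOn_of_deriv2_neg (convex_Icc _ _) hcont.continuousOn fun u hu => by
      rw [interior_Icc] at hu
      exact (hneg u hu).1.trans_lt (hneg u hu).2
  have hlt := hconc.lt_on_openSegment (Set.left_mem_Icc.2 hKpos.le)
    (Set.right_mem_Icc.2 hKpos.le) hKpos.ne (by rwa [openSegment_eq_Ioo hKpos])
  rwa [h0, h1, min_self] at hlt
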